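/- arXiv:2410.22226 — 2 statements merged into one kernel-verified Lean document; each statement's English description precedes it below -/
import Mathlib

section
/- Let N(x) denote the number of positive integers n ≤ x whose largest prime factor P₁(n) appears with multiplicity at least 2 in the prime factorization of n. Then N(x) = O(x/exp(½√(log x · log log x))) as x → ∞. -/
open Filter Asymptotics

/-- The `k`-th largest distinct prime factor of `n` (1-indexed);
equals `1` when `n` has fewer than `k` distinct prime factors. -/
def Pk (k n : ℕ) : ℕ := ((n.primeFactors.sort (· ≤ ·)).reverse).getD (k - 1) 1

namespace RLP

lemma Pk_max {n q : ℕ} (hq : q ∈ n.primeFactors) : q ≤ Pk 1 n := by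
  unfold Pk
  have hs : (n.primeFactors.sort (· ≤ ·)).Pairwise (· ≤ ·) := Finset.pairwise_sort _ _
  have hs' := List.pairwise_reverse.mpr (show (n.primeFactors.sort (· ≤ ·)).Pairwise
    (fun a b => (fun x y : ℕ => y ≤ x) b a) from hs)
  have hm : q ∈ (n.primeFactors.sort (· ≤ ·)).reverse := by simpa using hq
  generalize (n.primeFactors.sort (· ≤ ·)).reverse = l at hs' hm
  cases l with
  | nil => simp at hm
  | cons a tl =>
    simp only [List.pairwise_cons] at hs'
    rcases List.mem_cons.mp hm with h | h
    · simp [h]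
    · simpa using hs'.1 q h

lemma block (j : ℕ) (hj : 1 ≤ j) :
    ∑ p ∈ (Finset.Ioc (2 ^ j) (2 ^ (j + 1))).filter Nat.Prime, (1 / p : ℝ) ≤ 4 / j := by
  have hj' : (0:ℝ) < j := by exact_mod_cast hj
  have h2 : 0 < Real.log 2 := Real.log_pos (by norm_num)
  have h4 : Real.log 4 = 2 * Real.log 2 := by
    rw [show (4:ℝ) = 2 ^ 2 by norm_num, Real.log_pow]; norm_num
  have hth := Chebyshev.theta_le_log4_mul_x (x := ((2 ^ (j + 1) : ℕ) : ℝ)) (by positivity)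
  calc ∑ p ∈ (Finset.Ioc (2 ^ j) (2 ^ (j + 1))).filter Nat.Prime, (1 / p : ℝ)
      ≤ ∑ p ∈ (Finset.Ioc (2 ^ j) (2 ^ (j + 1))).filter Nat.Prime,
          Real.log p / (2 ^ j * (j * Real.log 2)) := by
        apply Finset.sum_le_sum
        intro p hp
        simp only [Finset.mem_filter, Finset.mem_Ioc] at hp
        have hp1 : (2:ℝ) ^ j ≤ p := by exact_mod_cast hp.1.1.le
        have hl : (j:ℝ) * Real.log 2 ≤ Real.log p := by
          rw [← Real.log_pow]; exact Real.log_le_log (by positivity) hp1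
        have : (0:ℝ) < 2 ^ j := by positivity
        have hp0 : (0:ℝ) < p := by linarith
        rw [div_le_div_iff₀ hp0 (by positivity)]
        have := mul_le_mul hp1 hl (by positivity) hp0.le
        linarith
    _ = (∑ p ∈ (Finset.Ioc (2 ^ j) (2 ^ (j + 1))).filter Nat.Prime, Real.log p)
          / (2 ^ j * (j * Real.log 2)) := by rw [Finset.sum_div]
    _ ≤ (Real.log 4 * ((2 ^ (j + 1) : ℕ) : ℝ)) / (2 ^ j * (j * Real.log 2)) := by
        gcongr
        refine le_trans ?_ hth
        rw [Chebyshev.theta, Nat.floor_natCast]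
        apply Finset.sum_le_sum_of_subset_of_nonneg
        · intro p hp
          simp only [Finset.mem_filter, Finset.mem_Ioc] at hp ⊢
          exact ⟨⟨hp.2.pos, hp.1.2⟩, hp.2⟩
        · intro p _ _
          exact Real.log_natCast_nonneg p
    _ = 4 / j := by
        rw [h4]; push_cast; field_simp; ring

lemma sum_prime (k : ℕ) :
    ∑ p ∈ (Finset.Ioc 0 (2 ^ (k + 1))).filter Nat.Prime, (1 / p : ℝ) ≤
      1 / 2 + 4 * (harmonic k : ℝ) := by
  induction k with
  | zero =>
    have : (Finset.Ioc 0 (2 ^ (0 + 1))).filter Nat.Prime = {2} := by decide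
    rw [this]; simp
  | succ k ih =>
    have hsplit : (Finset.Ioc 0 (2 ^ (k + 1 + 1))).filter Nat.Prime =
        (Finset.Ioc 0 (2 ^ (k + 1))).filter Nat.Prime ∪
        (Finset.Ioc (2 ^ (k + 1)) (2 ^ (k + 1 + 1))).filter Nat.Prime := by
      rw [← Finset.filter_union, Finset.Ioc_union_Ioc_eq_Ioc (by positivity)]
      exact Nat.pow_le_pow_right (by norm_num) (by omega)
    have h1 := Finset.sum_union_inter (s₁ := (Finset.Ioc 0 (2 ^ (k + 1))).filter Nat.Prime)
      (s₂ := (Finset.Ioc (2 ^ (k + 1)) (2 ^ (k + 1 + 1))).filter Nat.Prime)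
      (f := fun p : ℕ => (1 / p : ℝ))
    have h2 := block (k + 1) (by omega)
    have h3 : 0 ≤ ∑ p ∈ (Finset.Ioc 0 (2 ^ (k + 1))).filter Nat.Prime ∩
        (Finset.Ioc (2 ^ (k + 1)) (2 ^ (k + 1 + 1))).filter Nat.Prime, (1 / p : ℝ) :=
      Finset.sum_nonneg fun _ _ => by positivity
    rw [hsplit, harmonic_succ]
    push_cast at h2 ⊢
    have h4 : (4:ℝ) / (k + 1) = 4 * ((k:ℝ) + 1)⁻¹ := by rw [div_eq_mul_inv]
    linarith

lemma sum_prime' (M : ℕ) (L : ℝ) (hL : 1 ≤ L) (hM : (M : ℝ) ≤ Real.exp (L / 2) + 1) :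
    ∑ p ∈ M.primesBelow, (1 / p : ℝ) ≤ 5 + 4 * Real.log L := by
  have hk := sum_prime ⌊L⌋₊
  have hh := harmonic_floor_le_one_add_log L hL
  have hsub : ∑ p ∈ M.primesBelow, (1 / p : ℝ) ≤
      ∑ p ∈ (Finset.Ioc 0 (2 ^ (⌊L⌋₊ + 1))).filter Nat.Prime, (1 / p : ℝ) := by
    apply Finset.sum_le_sum_of_subset_of_nonneg
    · intro p hp
      have hp1 := Nat.prime_of_mem_primesBelow hp
      have hp2 := Nat.lt_of_mem_primesBelow hp
      simp only [Finset.mem_filter, Finset.mem_Ioc]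
      refine ⟨⟨hp1.pos, ?_⟩, hp1⟩
      have h1 : (p:ℝ) + 1 ≤ M := by exact_mod_cast hp2
      have h2 : Real.exp (L / 2) ≤ (2:ℝ) ^ (⌊L⌋₊ + 1) := by
        rw [← Real.rpow_natCast, Real.rpow_def_of_pos (by norm_num)]
        apply Real.exp_le_exp.mpr
        have := Real.log_two_gt_d9
        have h3 := (Nat.lt_floor_add_one L).le
        push_cast
        nlinarith
      have h3 : (p:ℝ) ≤ (2:ℝ) ^ (⌊L⌋₊ + 1) := by linarith
      exact_mod_cast h3
    · intros; positivity
  linarith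

noncomputable def fhom (s : ℝ) : ℕ →* ℝ where
  toFun n := (n : ℝ) ^ s
  map_one' := by simp
  map_mul' a b := by
    push_cast
    exact Real.mul_rpow (by positivity) (by positivity)

lemma rankin (x y δ : ℝ) (hx : 1 ≤ x) (hδ0 : 0 ≤ δ) (hδ : δ ≤ 1 / 2) (hy : 0 ≤ y) (M : ℕ)
    (hM : (M : ℝ) ≤ y + 1) (T : Finset ℕ) (hT : ∀ n ∈ T, n ∈ M.smoothNumbers ∧ (n : ℝ) ≤ x) :
    (T.card : ℝ) ≤ x ^ (1 - δ) *
      Real.exp (4 * (y ^ δ * ∑ p ∈ M.primesBelow, (1 / p : ℝ))) := by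
  have hx0 : 0 < x := by linarith
  have hprime : ∀ {p : ℕ}, p.Prime → (p : ℝ) ^ (-(1 - δ)) ≤ 3 / 4 := by
    intro p hp
    have h2 : (2:ℝ) ≤ p := by exact_mod_cast hp.two_le
    calc (p : ℝ) ^ (-(1 - δ)) ≤ (2:ℝ) ^ (-(1 - δ)) :=
          Real.rpow_le_rpow_of_nonpos (by norm_num) h2 (by linarith)
      _ ≤ (2:ℝ) ^ (-(1 / 2) : ℝ) :=
          Real.rpow_le_rpow_of_exponent_le (by norm_num) (by linarith)
      _ ≤ 3 / 4 := by
          rw [Real.rpow_neg (by norm_num), ← Real.sqrt_eq_rpow]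
          rw [inv_le_comm₀ (by positivity) (by norm_num)]
          apply Real.le_sqrt_of_sq_le; norm_num
  have hnn : ∀ n : ℕ, 0 ≤ fhom (-(1 - δ)) n := fun n => Real.rpow_nonneg (by positivity) _
  obtain ⟨hs1, hs2⟩ := EulerProduct.summable_and_hasSum_smoothNumbers_prod_primesBelow_geometric
    (f := fhom (-(1 - δ))) (fun {p} hp => by
      rw [Real.norm_of_nonneg (hnn p)]
      exact lt_of_le_of_lt (hprime hp) (by norm_num)) M
  have hsum : ∑ n ∈ T, fhom (-(1 - δ)) n ≤ ∏ p ∈ M.primesBelow, (1 - fhom (-(1 - δ)) p)⁻¹ := by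
    have := sum_le_hasSum (T.subtype (· ∈ M.smoothNumbers)) (fun i _ => hnn i) hs2
    rw [Finset.sum_subtype_of_mem (p := (· ∈ M.smoothNumbers)) (fun n => fhom (-(1 - δ)) n) (fun n hn => (hT n hn).1)] at this
    exact this
  have hprod : ∏ p ∈ M.primesBelow, (1 - fhom (-(1 - δ)) p)⁻¹ ≤
      Real.exp (4 * (y ^ δ * ∑ p ∈ M.primesBelow, (1 / p : ℝ))) := by
    rw [Finset.mul_sum, Finset.mul_sum, Real.exp_sum]
    apply Finset.prod_le_prod
    · intro p hp
      have := hprime (Nat.prime_of_mem_primesBelow hp)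
      apply inv_nonneg.mpr
      change 0 ≤ 1 - (p : ℝ) ^ (-(1 - δ))
      linarith
    · intro p hp
      have hpp := Nat.prime_of_mem_primesBelow hp
      have hp2 := Nat.lt_of_mem_primesBelow hp
      have h1 := hprime hpp
      have h0 : 0 < (p : ℝ) := by exact_mod_cast hpp.pos
      have hpy : (p : ℝ) ≤ y := by
        have : (p:ℝ) + 1 ≤ M := by exact_mod_cast hp2
        linarith
      have he : (p : ℝ) ^ (-(1 - δ)) ≤ y ^ δ * (1 / p) := by
        rw [show -(1 - δ) = δ - 1 by ring, Real.rpow_sub_one h0.ne', div_eq_mul_one_div]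
        gcongr
      have ht0 : 0 ≤ (p : ℝ) ^ (-(1 - δ)) := hnn p
      change (1 - (p : ℝ) ^ (-(1 - δ)))⁻¹ ≤ _
      generalize (p : ℝ) ^ (-(1 - δ)) = t at h1 he ht0
      have h3 : (1 - t)⁻¹ ≤ 1 + 4 * t := by
        rw [inv_le_iff_one_le_mul₀ (by linarith)]
        nlinarith
      have h4 := Real.add_one_le_exp (4 * t)
      have h5 : Real.exp (4 * t) ≤ Real.exp (4 * (y ^ δ * (1 / p))) :=
        Real.exp_le_exp.mpr (by linarith)
      linarith
  have hlow : (T.card : ℝ) * x ^ (-(1 - δ)) ≤ ∑ n ∈ T, fhom (-(1 - δ)) n := by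
    rw [← nsmul_eq_mul]
    apply Finset.card_nsmul_le_sum
    intro n hn
    have hn0 : 0 < (n:ℝ) := by
      exact_mod_cast Nat.pos_of_ne_zero (Nat.ne_zero_of_mem_smoothNumbers (hT n hn).1)
    exact Real.rpow_le_rpow_of_nonpos hn0 (hT n hn).2 (by linarith)
  have hfin := (hlow.trans hsum).trans hprod
  rw [Real.rpow_neg hx0.le, ← div_eq_mul_inv, div_le_iff₀ (by positivity)] at hfin
  linarith

lemma big (x : ℝ) (hx : 0 ≤ x) (M : ℕ) (hM : 1 ≤ M) (T : Finset ℕ)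
    (hT : ∀ n ∈ T, 1 ≤ n ∧ (n : ℝ) ≤ x ∧ ∃ m, M ≤ m ∧ m ^ 2 ∣ n) :
    (T.card : ℝ) ≤ x * (2 / M) := by
  obtain ⟨k, rfl⟩ : ∃ k, M = k + 1 := ⟨M - 1, by omega⟩
  set X := ⌊x⌋₊ with hX
  have hsub : T ⊆ (Finset.Ioo k (X + 1)).biUnion
      (fun m => (Finset.Ioc 0 X).filter (fun n => m ^ 2 ∣ n)) := by
    intro n hn
    obtain ⟨h1, h2, m, hm, hd⟩ := hT n hn
    have hnX : n ≤ X := Nat.le_floor h2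
    simp only [Finset.mem_biUnion, Finset.mem_Ioo, Finset.mem_filter, Finset.mem_Ioc]
    have : m ^ 2 ≤ n := Nat.le_of_dvd h1 hd
    exact ⟨m, ⟨by omega, by nlinarith⟩, ⟨h1, hnX⟩, hd⟩
  have hc := (Finset.card_le_card hsub).trans Finset.card_biUnion_le
  have hc' : (T.card : ℝ) ≤ ∑ m ∈ Finset.Ioo k (X + 1), x * ((m : ℝ) ^ 2)⁻¹ := by
    refine le_trans (by exact_mod_cast hc) (?_ : ((∑ m ∈ Finset.Ioo k (X + 1),
      ((Finset.Ioc 0 X).filter (fun n => m ^ 2 ∣ n)).card : ℕ) : ℝ) ≤ _)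
    push_cast
    apply Finset.sum_le_sum
    intro m hm
    rw [Nat.Ioc_filter_dvd_card_eq_div]
    refine Nat.cast_div_le.trans ?_
    push_cast
    rw [div_eq_mul_inv]
    gcongr
    exact Nat.floor_le hx
  rw [← Finset.mul_sum] at hc'
  refine hc'.trans ?_
  have := sum_Ioo_inv_sq_le (α := ℝ) k (X + 1)
  push_cast
  gcongr

lemma ev : ∀ᶠ t : ℝ in atTop, 16 * (5 + 4 * t) ≤ Real.exp (t / 8) := by
  have h : Tendsto (fun t : ℝ => Real.exp (t / 8) / (t / 8) ^ 1) atTop atTop :=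
    (Real.tendsto_exp_div_pow_atTop 1).comp (tendsto_id.atTop_div_const (by norm_num))
  filter_upwards [h.eventually_ge_atTop 1200, eventually_ge_atTop 1] with t ht ht1
  rw [pow_one, le_div_iff₀ (by positivity)] at ht
  linarith

end RLP

/-- **Theorem 1.4.** The number of positive integers `n ≤ x` whose largest prime
factor occurs with multiplicity at least `2` in `n` is
`O(x / exp(½ √(log x · log log x)))`. -/
theorem repeated_largest_prime_factor_count :
    (fun x : ℝ =>
        ((((Finset.Icc 1 ⌊x⌋₊).filter fun n => 2 ≤ n.factorization (Pk 1 n)).card : ℝ)))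
      =O[atTop]
      fun x : ℝ =>
        x / Real.exp ((1 / 2) * Real.sqrt (Real.log x * Real.log (Real.log x))) := by
  apply IsBigO.of_bound 3
  have hll : Tendsto (fun x : ℝ => Real.log (Real.log x)) atTop atTop :=
    Real.tendsto_log_atTop.comp Real.tendsto_log_atTop
  filter_upwards [hll.eventually RLP.ev, hll.eventually_ge_atTop 1, eventually_ge_atTop 1,
    Real.tendsto_log_atTop.eventually_ge_atTop 1] with x hev ht hx hl
  have hx0 : 0 < x := by linarith
  have hlt : Real.log x = Real.exp (Real.log (Real.log x)) := (Real.exp_log (by linarith)).symm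
  generalize Real.log (Real.log x) = t at hev ht hlt
  have hxl : x = Real.exp (Real.log x) := (Real.exp_log hx0).symm
  generalize hl' : Real.log x = l at *
  have hl0 : 0 < l := by linarith
  have hL2 : Real.sqrt (l * t) ^ 2 = l * t := Real.sq_sqrt (by positivity)
  generalize hL' : Real.sqrt (l * t) = L at hL2
  have hL0 : 0 ≤ L := by rw [← hL']; positivity
  have hexp : Real.exp (t / 8) ≤ l := by
    rw [hlt]; exact Real.exp_le_exp.mpr (by linarith)
  have hL1 : 1 ≤ L := by nlinarith
  have hLl : L ≤ l * (1 / 2) := by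
    refine (pow_le_pow_iff_left₀ (by positivity) (by positivity) two_ne_zero).mp ?_
    nlinarith
  have hlogL : Real.log L ≤ t := by
    rw [Real.log_le_iff_le_exp (by linarith), ← hlt]; linarith
  set y := Real.exp (L / 2) with hy
  set M := ⌊y⌋₊ + 1 with hM
  have hMy : (M : ℝ) ≤ y + 1 := by
    rw [hM]; push_cast; linarith [Nat.floor_le (Real.exp_pos (L / 2)).le]
  have hyM : y ≤ M := by
    rw [hM]; push_cast; exact (Nat.lt_floor_add_one y).le
  set S := (Finset.Icc 1 ⌊x⌋₊).filter fun n => 2 ≤ n.factorization (Pk 1 n) with hS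
  have hSx : ∀ n ∈ S, 1 ≤ n ∧ (n : ℝ) ≤ x ∧ Pk 1 n ^ 2 ∣ n := by
    intro n hn
    simp only [hS, Finset.mem_filter, Finset.mem_Icc] at hn
    refine ⟨hn.1.1, (Nat.le_floor_iff hx0.le).mp hn.1.2, ?_⟩
    exact (pow_dvd_pow _ hn.2).trans (Nat.ordProj_dvd n _)
  have hA := RLP.big x hx0.le M (by omega) (S.filter fun n => M ≤ Pk 1 n) (by
    intro n hn
    rw [Finset.mem_filter] at hn
    obtain ⟨h1, h2, h3⟩ := hSx n hn.1
    exact ⟨h1, h2, _, hn.2, h3⟩)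
  have hB := RLP.rankin x y (3 / 4 * (L / l)) hx (by positivity) (by
      have : L / l ≤ 1 / 2 := by rw [div_le_iff₀ hl0]; linarith
      linarith) (Real.exp_pos _).le M hMy (S.filter fun n => ¬ M ≤ Pk 1 n) (by
    intro n hn
    rw [Finset.mem_filter] at hn
    obtain ⟨h1, h2, h3⟩ := hSx n hn.1
    refine ⟨?_, h2⟩
    rw [Nat.mem_smoothNumbers]
    refine ⟨by omega, fun p hp => ?_⟩
    have := RLP.Pk_max (Nat.mem_primeFactors_iff_mem_primeFactorsList.mpr hp)
    omega)
  have hP := RLP.sum_prime' M L hL1 hMy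
  have hcard : (S.card : ℝ) = ((S.filter fun n => M ≤ Pk 1 n).card : ℝ) +
      ((S.filter fun n => ¬ M ≤ Pk 1 n).card : ℝ) := by
    exact_mod_cast (Finset.card_filter_add_card_filter_not (s := S) (fun n => M ≤ Pk 1 n)).symm
  have hy0 : 0 < y := Real.exp_pos _
  have hA' : x * (2 / M) ≤ 2 * (x / y) := by
    have : 2 / (M : ℝ) ≤ 2 / y := by gcongr
    calc x * (2 / M) ≤ x * (2 / y) := by gcongr
      _ = 2 * (x / y) := by ring
  have hyd : y ^ (3 / 4 * (L / l)) = Real.exp (3 / 8 * t) := by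
    rw [hy, ← Real.exp_mul]
    congr 1
    field_simp
    rw [hL2]; ring
  have hxd : x ^ (1 - 3 / 4 * (L / l)) = x * Real.exp (-(3 / 4 * L)) := by
    rw [Real.rpow_sub hx0, Real.rpow_one, Real.rpow_def_of_pos hx0, hl', div_eq_mul_inv,
      ← Real.exp_neg]
    congr 3
    field_simp
  have hkey : 4 * (Real.exp (3 / 8 * t) * ∑ p ∈ M.primesBelow, (1 / p : ℝ)) ≤ L / 4 := by
    have h1 : Real.exp (t / 2) ≤ L := by
      refine (pow_le_pow_iff_left₀ (by positivity) (by positivity) two_ne_zero).mp ?_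
      rw [← Real.exp_nat_mul, hL2]
      rw [show ((2:ℕ):ℝ) * (t / 2) = t by push_cast; ring, ← hlt]
      nlinarith
    have h2 : Real.exp (t / 2) = Real.exp (3 / 8 * t) * Real.exp (t / 8) := by
      rw [← Real.exp_add]; congr 1; ring
    have h3 : 16 * ∑ p ∈ M.primesBelow, (1 / p : ℝ) ≤ Real.exp (t / 8) := by linarith
    have h4 := mul_le_mul_of_nonneg_left h3 (Real.exp_pos (3 / 8 * t)).le
    linarith
  have hB' : x ^ (1 - 3 / 4 * (L / l)) * Real.exp (4 * (y ^ (3 / 4 * (L / l)) *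
      ∑ p ∈ M.primesBelow, (1 / p : ℝ))) ≤ x / y := by
    rw [hyd, hxd, hy, div_eq_mul_inv x, ← Real.exp_neg, mul_assoc, ← Real.exp_add]
    gcongr
    linarith
  have hfin : (S.card : ℝ) ≤ 3 * (x / y) := by linarith
  have hxy : 0 ≤ x / y := div_nonneg hx0.le hy0.le
  rw [show (1:ℝ) / 2 * L = L / 2 by ring, ← hy, Real.norm_of_nonneg (Nat.cast_nonneg _),
    Real.norm_of_nonneg hxy]
  exact hfin
end

section
/- (Tenenbaum) Uniformly for 2 ≤ y ≤ x, the number of positive integers n ≤ x whose second largest prime factor P₂(n) satisfies P₂(n) ≤ y is O(x · log y / log x). -/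
open scoped Classical

lemma fact_ge (M p : ℕ) (hp : p.Prime) : M / p ≤ (M.factorial).factorization p := by
  have := Fact.mk hp
  rw [Nat.factorization_def _ hp]
  by_cases h : p ≤ M
  · rw [padicValNat_factorial (b := Nat.log p M + 1) (Nat.lt_succ_self _)]
    have h1 : 1 ∈ Finset.Ico 1 (Nat.log p M + 1) := by
      simp only [Finset.mem_Ico, le_refl, true_and]
      have := Nat.log_pos hp.one_lt h
      omega
    have := Finset.single_le_sum (f := fun i => M / p ^ i) (fun _ _ => Nat.zero_le _) h1
    simpa using this
  · rw [Nat.div_eq_of_lt (by omega)]; exact Nat.zero_le _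

lemma fact_le (N p : ℕ) (hp : p.Prime) :
    ((N.factorial).factorization p : ℝ) ≤ 2 * N / p := by
  have := Fact.mk hp
  rw [Nat.factorization_def _ hp]
  have h := sub_one_mul_padicValNat_factorial (p := p) N
  have h1 : (p - 1) * padicValNat p N.factorial ≤ N := by omega
  have h2 := hp.two_le
  have h3 : p * padicValNat p N.factorial ≤ 2 * N := by
    obtain ⟨k, rfl⟩ : ∃ k, p = k + 2 := ⟨p - 2, by omega⟩
    have : k + 2 - 1 = k + 1 := by omega
    rw [this] at h1
    nlinarith
  have hp0 : (0 : ℝ) < p := by exact_mod_cast hp.pos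
  rw [le_div_iff₀ hp0]
  have : ((p * padicValNat p N.factorial : ℕ) : ℝ) ≤ ((2 * N : ℕ) : ℝ) := by exact_mod_cast h3
  push_cast at this
  linarith

lemma log_eq_sum (n N : ℕ) (h : ∀ p, p.Prime → p ∣ n → p ≤ N) :
    Real.log n = ∑ p ∈ Nat.primesLE N, (n.factorization p : ℝ) * Real.log p := by
  rw [Real.log_nat_eq_sum_factorization, Finsupp.sum]
  refine Finset.sum_subset (s₁ := n.factorization.support) ?_ ?_
  · intro p hp
    have hp' := Nat.support_factorization n ▸ hp
    rw [Nat.mem_primesLE]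
    exact ⟨h p (Nat.prime_of_mem_primeFactors hp') (Nat.dvd_of_mem_primeFactors hp'),
      Nat.prime_of_mem_primeFactors hp'⟩
  · intro p _ hp
    rw [Finsupp.notMem_support_iff.mp hp]; simp

lemma mertens_one (M : ℕ) (hM : 1 ≤ M) :
    ∑ p ∈ Nat.primesLE M, Real.log p / p ≤ Real.log M + Real.log 4 := by
  have hM0 : (0 : ℝ) < M := by exact_mod_cast hM
  have h1 : Real.log (M.factorial) ≤ M * Real.log M := by
    rw [← Real.log_pow]
    apply Real.log_le_log (by exact_mod_cast Nat.factorial_pos M)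
    exact_mod_cast Nat.factorial_le_pow M
  have h2 := log_eq_sum M.factorial M (fun p hp h => (hp.dvd_factorial).1 h)
  have h3 : ∑ p ∈ Nat.primesLE M, ((M : ℝ) / p - 1) * Real.log p ≤ Real.log (M.factorial) := by
    rw [h2]
    apply Finset.sum_le_sum
    intro p hp
    have hpp := Nat.prime_of_mem_primesLE hp
    apply mul_le_mul_of_nonneg_right _ (Real.log_natCast_nonneg p)
    have a1 : ((M / p : ℕ) : ℝ) ≤ (M.factorial).factorization p := by
      exact_mod_cast fact_ge M p hpp
    have a2 := Nat.lt_floor_add_one ((M : ℝ) / p)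
    rw [Nat.floor_div_natCast, Nat.floor_natCast] at a2
    linarith
  have h4 : ∑ p ∈ Nat.primesLE M, Real.log p ≤ Real.log 4 * M := by
    rw [← Chebyshev.theta_eq_sum_primesLE_log]
    exact Chebyshev.theta_le_log4_mul_x hM0.le
  have h5 : ∑ p ∈ Nat.primesLE M, ((M : ℝ) / p - 1) * Real.log p
      = M * ∑ p ∈ Nat.primesLE M, Real.log p / p - ∑ p ∈ Nat.primesLE M, Real.log p := by
    rw [Finset.mul_sum, ← Finset.sum_sub_distrib]
    apply Finset.sum_congr rfl
    intro p _
    ring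
  have : M * ∑ p ∈ Nat.primesLE M, Real.log p / p ≤ M * (Real.log M + Real.log 4) := by linarith
  exact le_of_mul_le_mul_left this hM0

lemma zeta_part (d : ℝ) (hd : 0 < d) (n : ℕ) :
    ∑ i ∈ Finset.range (n + 2), (i : ℝ) ^ (-(1 + d)) ≤ 1 + 1 / d - ((n : ℝ) + 1) ^ (-d) / d := by
  induction n with
  | zero =>
    rw [Finset.sum_range_succ, Finset.sum_range_one]
    have : (-(1 + d)) ≠ 0 := by linarith
    rw [Nat.cast_zero, Real.zero_rpow this]
    simp
  | succ n ih =>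
    rw [Finset.sum_range_succ]
    have key : ((n + 2 : ℕ) : ℝ) ^ (-(1 + d)) ≤
        ((n : ℝ) + 1) ^ (-d) / d - (((n + 1 : ℕ) : ℝ) + 1) ^ (-d) / d := by
      have e : (((n + 1 : ℕ) : ℝ) + 1) = (n : ℝ) + 2 := by push_cast; ring
      rw [e]
      push_cast
      have p1 : (0 : ℝ) < (n : ℝ) + 1 := by positivity
      have p2 : (0 : ℝ) < (n : ℝ) + 2 := by positivity
      have e1 : ((n : ℝ) + 2) ^ (-(1 + d)) = ((n : ℝ) + 2) ^ (-d) / ((n : ℝ) + 2) := by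
        rw [show -(1 + d) = -d - 1 by ring, Real.rpow_sub_one p2.ne']
      have e2 : ((n : ℝ) + 2) ^ (-d) * (1 + d / ((n : ℝ) + 2)) ≤ ((n : ℝ) + 1) ^ (-d) := by
        rw [Real.rpow_def_of_pos p2, Real.rpow_def_of_pos p1]
        have l1 : Real.log ((n : ℝ) + 1) - Real.log ((n : ℝ) + 2) ≤ - (1 / ((n : ℝ) + 2)) := by
          rw [← Real.log_div p1.ne' p2.ne']
          have := Real.log_le_sub_one_of_pos (div_pos p1 p2)
          have e3 : ((n : ℝ) + 1) / (n + 2) - 1 = - (1 / ((n : ℝ) + 2)) := by field_simp; ring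
          linarith
        have l2 : 1 + d / ((n : ℝ) + 2) ≤ Real.exp (d / ((n : ℝ) + 2)) := by
          have := Real.add_one_le_exp (d / ((n : ℝ) + 2)); linarith
        calc _ ≤ Real.exp (Real.log ((n : ℝ) + 2) * -d) * Real.exp (d / ((n : ℝ) + 2)) := by gcongr
          _ = Real.exp (Real.log ((n : ℝ) + 2) * -d + d / ((n : ℝ) + 2)) := by rw [Real.exp_add]
          _ ≤ _ := by
            apply Real.exp_le_exp.2
            have := mul_le_mul_of_nonneg_left l1 hd.le
            have e4 : d / ((n : ℝ) + 2) = d * (1 / ((n : ℝ) + 2)) := by ring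
            nlinarith
      rw [e1, ← sub_div, le_div_iff₀ hd]
      have e5 : ((n : ℝ) + 2) ^ (-d) / ((n : ℝ) + 2) * d
        = ((n : ℝ) + 2) ^ (-d) * (1 + d / ((n : ℝ) + 2)) - ((n : ℝ) + 2) ^ (-d) := by ring
      linarith
    linarith

lemma zeta_le (d : ℝ) (hd : 0 < d) : ∑' i : ℕ, (i : ℝ) ^ (-(1 + d)) ≤ 1 + 1 / d := by
  apply Real.tsum_le_of_sum_range_le
  · intro n; positivity
  · intro n
    calc _ ≤ ∑ i ∈ Finset.range (n + 2), (i : ℝ) ^ (-(1 + d)) := by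
          apply Finset.sum_le_sum_of_subset_of_nonneg
          · exact Finset.range_subset_range.2 (by omega)
          · intro i _ _; positivity
      _ ≤ _ := zeta_part d hd n
      _ ≤ _ := by
        have : 0 ≤ ((n : ℝ) + 1) ^ (-d) / d := by positivity
        linarith

/-- `n ↦ n ^ (-s)` -/
noncomputable def powHom (s : ℝ) : ℕ →* ℝ where
  toFun n := (n : ℝ) ^ (-s)
  map_one' := by simp
  map_mul' a b := by
    push_cast
    exact Real.mul_rpow (by positivity) (by positivity)

lemma powHom_lt (s : ℝ) (hs : 0 < s) {p : ℕ} (hp : p.Prime) : ‖powHom s p‖ < 1 := by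
  have : powHom s p = (p : ℝ) ^ (-s) := rfl
  rw [this, Real.norm_of_nonneg (by positivity)]
  exact Real.rpow_lt_one_of_one_lt_of_neg (by exact_mod_cast hp.one_lt) (by linarith)

lemma smooth_le_prod (N K : ℕ) :
    ∑ m ∈ Finset.Icc 1 N with m ∈ Nat.smoothNumbers (K + 1), (1 : ℝ) / m ≤
      ∏ p ∈ Nat.primesLE K, (1 - powHom 1 p)⁻¹ := by
  have h := (EulerProduct.summable_and_hasSum_smoothNumbers_prod_primesBelow_geometric
    (f := powHom 1) (powHom_lt 1 one_pos) (K + 1)).2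
  have h2 := (hasSum_subtype_iff_indicator (f := fun n => powHom 1 n)).1 h
  have h3 := sum_le_hasSum (Finset.Icc 1 N) (fun i _ => by
    apply Set.indicator_nonneg
    intro x _
    change (0 : ℝ) ≤ (x : ℝ) ^ (-(1 : ℝ))
    positivity) h2
  refine le_trans (le_of_eq ?_) h3
  rw [Finset.sum_filter]
  apply Finset.sum_congr rfl
  intro m _
  rw [Set.indicator_apply]
  have : powHom 1 m = (m : ℝ) ^ (-(1 : ℝ)) := rfl
  rw [this, Real.rpow_neg_one, one_div]

lemma prod_le_zeta (K : ℕ) (d : ℝ) (hd : 0 < d) :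
    ∏ p ∈ Nat.primesLE K, (1 - powHom (1 + d) p)⁻¹ ≤ 1 + 1 / d := by
  have h := (EulerProduct.summable_and_hasSum_smoothNumbers_prod_primesBelow_geometric
    (f := powHom (1 + d)) (powHom_lt _ (by linarith)) (K + 1)).2
  have h2 := (hasSum_subtype_iff_indicator (f := fun n => powHom (1 + d) n)).1 h
  have hs : Summable (fun n : ℕ => (n : ℝ) ^ (-(1 + d))) :=
    Real.summable_nat_rpow.2 (by linarith)
  refine le_trans ?_ (zeta_le d hd)
  refine hasSum_le ?_ h2 hs.hasSum
  intro n
  rw [Set.indicator_apply]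
  split_ifs
  · exact le_rfl
  · positivity

lemma ratio_le (p : ℕ) (hp : p.Prime) (d : ℝ) (hd : 0 < d) :
    (1 - powHom 1 p)⁻¹ ≤ (1 - powHom (1 + d) p)⁻¹ * Real.exp (2 * d * (Real.log p / p)) := by
  have a1 : powHom 1 p = 1 / p := by
    change (p : ℝ) ^ (-(1 : ℝ)) = _
    rw [Real.rpow_neg_one, one_div]
  have hp2 : (2 : ℝ) ≤ p := by exact_mod_cast hp.two_le
  have hp0 : (0 : ℝ) < p := by linarith
  have a2 : powHom (1 + d) p = 1 / p * Real.exp (-(d * Real.log p)) := by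
    change (p : ℝ) ^ (-(1 + d)) = _
    rw [show -(1 + d) = -1 + -d by ring, Real.rpow_add hp0, Real.rpow_neg_one, one_div,
      Real.rpow_def_of_pos hp0]
    congr 2; ring
  have hb : powHom (1 + d) p < 1 := lt_of_le_of_lt (le_abs_self _) (powHom_lt _ (by linarith) hp)
  have h12 : (1 : ℝ) / p ≤ 1 / 2 := one_div_le_one_div_of_le two_pos hp2
  have hpi : (0 : ℝ) < 1 / p := by positivity
  have hl : 0 ≤ Real.log p := Real.log_natCast_nonneg p
  rw [inv_mul_eq_div, le_div_iff₀ (by linarith), inv_mul_eq_div, div_le_iff₀ (by linarith), a2, a1]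
  have e1 := Real.add_one_le_exp (-(d * Real.log p))
  have e2 := Real.add_one_le_exp (2 * d * (Real.log p / p))
  have e3 : Real.log p / p = 1 / p * Real.log p := by ring
  rw [e3] at e2 ⊢
  set u := (1 : ℝ) / p
  set t := d * Real.log p with ht
  have ht0 : 0 ≤ t := by positivity
  have e4 : 2 * d * (u * Real.log p) = 2 * (u * t) := by rw [ht]; ring
  rw [e4] at e2 ⊢
  have f1 : u * (-t + 1) ≤ u * Real.exp (-t) := mul_le_mul_of_nonneg_left e1 hpi.le
  have f2 : (2 * (u * t) + 1) * (1 - u) ≤ Real.exp (2 * (u * t)) * (1 - u) :=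
    mul_le_mul_of_nonneg_right e2 (by linarith)
  have f3 : 0 ≤ u * t := by positivity
  nlinarith [mul_nonneg f3 (show 0 ≤ 1 - 2 * u by linarith)]

lemma smooth_sum : ∃ C : ℝ, 0 < C ∧ ∀ N K : ℕ, 2 ≤ K →
    ∑ m ∈ Finset.Icc 1 N with m ∈ Nat.smoothNumbers (K + 1), (1 : ℝ) / m ≤ C * Real.log K := by
  have hl2 : 0 < Real.log 2 := Real.log_pos (by norm_num)
  refine ⟨(1 / Real.log 2 + 1) * Real.exp 6, by positivity, ?_⟩
  intro N K hK
  have hK2 : (2 : ℝ) ≤ K := by exact_mod_cast hK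
  have hL : Real.log 2 ≤ Real.log K := Real.log_le_log two_pos hK2
  have hL0 : 0 < Real.log K := by linarith
  set d := 1 / Real.log K with hd
  have hd0 : 0 < d := by positivity
  refine (smooth_le_prod N K).trans ?_
  have h1 : ∏ p ∈ Nat.primesLE K, (1 - powHom 1 p)⁻¹ ≤
      ∏ p ∈ Nat.primesLE K, ((1 - powHom (1 + d) p)⁻¹ * Real.exp (2 * d * (Real.log p / p))) := by
    apply Finset.prod_le_prod
    · intro p hp
      have := powHom_lt 1 one_pos (Nat.prime_of_mem_primesLE hp)
      have := lt_of_le_of_lt (le_abs_self _) this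
      exact inv_nonneg.2 (by linarith)
    · intro p hp
      exact ratio_le p (Nat.prime_of_mem_primesLE hp) d hd0
  refine h1.trans ?_
  rw [Finset.prod_mul_distrib, ← Real.exp_sum, ← Finset.mul_sum]
  have h2 := mertens_one K (by omega)
  have l4 : Real.log 4 = 2 * Real.log 2 := by
    rw [show (4 : ℝ) = 2 ^ 2 by norm_num, Real.log_pow]; norm_num
  have h3 : 2 * d * ∑ p ∈ Nat.primesLE K, Real.log p / p ≤ 6 := by
    calc _ ≤ 2 * d * (3 * Real.log K) := by gcongr; linarith
      _ = 6 := by rw [hd]; field_simp; norm_num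
  have h4 : 1 + 1 / d ≤ (1 / Real.log 2 + 1) * Real.log K := by
    rw [hd, one_div_one_div, add_mul, one_mul]
    have : 1 ≤ 1 / Real.log 2 * Real.log K := by
      rw [one_div_mul_eq_div, le_div_iff₀ hl2]; linarith
    linarith
  calc _ ≤ (1 + 1 / d) * Real.exp 6 := by
        apply mul_le_mul (prod_le_zeta K d hd0) (Real.exp_le_exp.2 h3) (Real.exp_pos _).le
        positivity
    _ ≤ (1 / Real.log 2 + 1) * Real.log K * Real.exp 6 := by gcongr
    _ = _ := by ring

lemma prod_Icc_fact (N : ℕ) : ∏ n ∈ Finset.Icc 1 N, n = N.factorial := by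
  rw [← Finset.prod_Ico_id_eq_factorial]
  rfl

lemma Pk_char (n : ℕ) (y : ℝ) (h : (Pk 2 n : ℝ) ≤ y) :
    ∃ p, ∀ q, q.Prime → q ∣ n → n ≠ 0 → q ≠ p → q ≤ ⌊y⌋₊ := by
  unfold Pk at h
  have hmem : ∀ q, q ∈ (n.primeFactors.sort (· ≤ ·)).reverse ↔ q ∈ n.primeFactors := by
    intro q; simp
  have hs : ((n.primeFactors.sort (· ≤ ·)).reverse).Pairwise (fun a b => b ≤ a) := by
    rw [List.pairwise_reverse]
    exact Finset.pairwise_sort _ _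
  generalize (n.primeFactors.sort (· ≤ ·)).reverse = L at h hmem hs
  have key : ∃ p, ∀ q ∈ L, q ≠ p → q ≤ ⌊y⌋₊ := by
    match L, h, hs with
    | [], _, _ => exact ⟨0, by simp⟩
    | [p], _, _ => exact ⟨p, by simp⟩
    | p :: q :: r, h, hs =>
      refine ⟨p, ?_⟩
      simp only [Nat.add_one_sub_one, List.getD_cons_succ, List.getD_cons_zero] at h
      have hq : q ≤ ⌊y⌋₊ := Nat.le_floor h
      intro t ht htp
      rcases List.mem_cons.1 ht with rfl | ht
      · exact absurd rfl htp
      rcases List.mem_cons.1 ht with rfl | ht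
      · exact hq
      · have := (List.pairwise_cons.1 (List.pairwise_cons.1 hs).2).1 t ht
        omega
  obtain ⟨p, hp⟩ := key
  exact ⟨p, fun q hq hqn hn hqp => hp q ((hmem q).2 (Nat.mem_primeFactors.2 ⟨hq, hqn, hn⟩)) hqp⟩

/-- smooth part -/
noncomputable def wA (K n : ℕ) : ℝ :=
  ∑ q ∈ Nat.primesLE K, (n.factorization q : ℝ) * Real.log q

/-- smooth times a prime -/
noncomputable def wB (N K n : ℕ) : ℝ :=
  ∑ m ∈ Finset.Icc 1 N with m ∈ Nat.smoothNumbers (K + 1),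
    ∑ p ∈ Nat.primesLE N, if n = m * p then Real.log p else 0

/-- square divisors -/
noncomputable def wD (N n : ℕ) : ℝ :=
  ∑ b ∈ Finset.Icc 1 N, if b ^ 2 ∣ n then Real.log b else 0

lemma wB_nonneg (N K n : ℕ) : 0 ≤ wB N K n := by
  refine Finset.sum_nonneg fun m _ => Finset.sum_nonneg fun p _ => ?_
  split_ifs
  · exact Real.log_natCast_nonneg p
  · exact le_rfl

lemma wD_nonneg (N n : ℕ) : 0 ≤ wD N n := by
  refine Finset.sum_nonneg fun p _ => ?_
  split_ifs
  · exact Real.log_natCast_nonneg p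
  · exact le_rfl

lemma wA_nonneg (K n : ℕ) : 0 ≤ wA K n :=
  Finset.sum_nonneg fun p _ => mul_nonneg (Nat.cast_nonneg _) (Real.log_natCast_nonneg p)

lemma pointwise (N K n : ℕ) (hn1 : 1 ≤ n) (hnN : n ≤ N)
    (h : ∃ p, ∀ q, q.Prime → q ∣ n → n ≠ 0 → q ≠ p → q ≤ K) :
    Real.log n ≤ wA K n + wB N K n + 3 * wD N n := by
  have hB := wB_nonneg N K n
  have hD := wD_nonneg N n
  have hn0 : n ≠ 0 := by omega
  by_cases hsm : ∀ q, q.Prime → q ∣ n → q ≤ K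
  · have : Real.log n = wA K n := log_eq_sum n K hsm
    linarith
  push Not at hsm
  obtain ⟨q, hq, hqn, hqK⟩ := hsm
  obtain ⟨p, hp⟩ := h
  have hqp : q = p := by
    by_contra hne
    have := hp q hq hqn hn0 hne
    omega
  subst hqp
  set j := n.factorization q with hj
  set m := n / q ^ j with hm
  have hmul : q ^ j * m = n := Nat.ordProj_mul_ordCompl_eq_self n q
  have hm0 : m ≠ 0 := by rintro h0; rw [h0] at hmul; omega
  have hmn : m ∣ n := ⟨q ^ j, by rw [mul_comm]; exact hmul.symm⟩
  have hj1 : 1 ≤ j := (hq.dvd_iff_one_le_factorization hn0).1 hqn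
  have hqm : ¬ q ∣ m := Nat.not_dvd_ordCompl hq hn0
  have hms : ∀ r, r.Prime → r ∣ m → r ≤ K := by
    intro r hr hrm
    apply hp r hr (hrm.trans hmn) hn0
    rintro rfl
    exact hqm hrm
  have hlog : Real.log n = j * Real.log q + Real.log m := by
    rw [← hmul]
    push_cast
    rw [Real.log_mul (by exact_mod_cast pow_ne_zero _ hq.ne_zero) (by exact_mod_cast hm0),
      Real.log_pow]
  have hlm : Real.log m ≤ wA K n := by
    rw [log_eq_sum m K hms]
    refine Finset.sum_le_sum fun r _ => ?_
    apply mul_le_mul_of_nonneg_right _ (Real.log_natCast_nonneg r)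
    exact_mod_cast (Nat.factorization_le_iff_dvd hm0 hn0).2 hmn r
  have hlq : 0 ≤ Real.log q := Real.log_natCast_nonneg q
  have hqN : q ≤ N := (Nat.le_of_dvd hn1 hqn).trans hnN
  have hmN : m ≤ N := (Nat.le_of_dvd hn1 hmn).trans hnN
  rcases Nat.lt_or_ge 1 j with hj2 | hj2
  · have hb2 : (q ^ (j / 2)) ^ 2 ∣ n := by
      rw [← pow_mul]
      exact (pow_dvd_pow q (by omega)).trans ⟨m, hmul.symm⟩
    have hbpos : 1 ≤ q ^ (j / 2) := Nat.pow_pos hq.pos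
    have hbN : q ^ (j / 2) ≤ N := by
      have := Nat.le_of_dvd hn1 hb2
      nlinarith
    have : Real.log ((q ^ (j / 2) : ℕ) : ℝ) ≤ wD N n := by
      have := Finset.single_le_sum (s := Finset.Icc 1 N)
        (f := fun b : ℕ => if b ^ 2 ∣ n then Real.log b else 0)
        (fun b _ => by
          split_ifs
          · exact Real.log_natCast_nonneg b
          · exact le_rfl) (Finset.mem_Icc.2 ⟨hbpos, hbN⟩)
      simp only [hb2, if_true] at this
      exact this
    push_cast at this
    rw [Real.log_pow] at this
    have h3 : (j : ℝ) ≤ 3 * ((j / 2 : ℕ) : ℝ) := by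
      have : j ≤ 3 * (j / 2) := by omega
      exact_mod_cast this
    nlinarith [mul_le_mul_of_nonneg_right h3 hlq]
  · have hj' : j = 1 := by omega
    have : Real.log q ≤ wB N K n := by
      have hmS : m ∈ (Finset.Icc 1 N).filter (fun m => m ∈ Nat.smoothNumbers (K + 1)) := by
        rw [Finset.mem_filter, Finset.mem_Icc]
        refine ⟨⟨Nat.one_le_iff_ne_zero.2 hm0, hmN⟩, ?_⟩
        rw [Nat.mem_smoothNumbers']
        intro r hr hrm
        have := hms r hr hrm
        omega
      have hn' : n = m * q := by rw [← hmul, hj']; ring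
      have h1 := Finset.single_le_sum
        (f := fun m : ℕ => ∑ p ∈ Nat.primesLE N, if n = m * p then Real.log p else 0)
        (fun b _ => Finset.sum_nonneg fun p _ => by
          split_ifs
          · exact Real.log_natCast_nonneg p
          · exact le_rfl) hmS
      have h2 := Finset.single_le_sum
        (f := fun p : ℕ => if n = m * p then Real.log p else 0)
        (fun b _ => by
          split_ifs
          · exact Real.log_natCast_nonneg b
          · exact le_rfl) (Nat.mem_primesLE.2 ⟨hqN, hq⟩)
      simp only [hn'.symm, if_true] at h2
      exact h2.trans h1
    rw [hlog, hj']
    push_cast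
    linarith

lemma sumA (N K : ℕ) (hK : 2 ≤ K) :
    ∑ n ∈ Finset.Icc 1 N, wA K n ≤ N * (6 * Real.log K) := by
  unfold wA
  rw [Finset.sum_comm]
  have h1 : ∀ q ∈ Nat.primesLE K,
      ∑ n ∈ Finset.Icc 1 N, (n.factorization q : ℝ) * Real.log q ≤ 2 * N * (Real.log q / q) := by
    intro q hq
    rw [← Finset.sum_mul]
    have e : ∑ n ∈ Finset.Icc 1 N, (n.factorization q : ℝ) = (N.factorial).factorization q := by
      rw [← prod_Icc_fact, Nat.factorization_prod]
      · simp
      · intro x hx; have := (Finset.mem_Icc.1 hx).1; omega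
    rw [e]
    have := mul_le_mul_of_nonneg_right (fact_le N q (Nat.prime_of_mem_primesLE hq))
      (Real.log_natCast_nonneg q)
    refine this.trans (le_of_eq ?_)
    ring
  refine (Finset.sum_le_sum h1).trans ?_
  rw [← Finset.mul_sum]
  have h2 := mertens_one K (by omega)
  have l4 : Real.log 4 = 2 * Real.log 2 := by
    rw [show (4 : ℝ) = 2 ^ 2 by norm_num, Real.log_pow]; norm_num
  have hL : Real.log 2 ≤ Real.log K := Real.log_le_log two_pos (by exact_mod_cast hK)
  calc _ ≤ 2 * (N : ℝ) * (3 * Real.log K) := by gcongr; linarith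
    _ = _ := by ring

lemma sumB (N K : ℕ) :
    ∑ n ∈ Finset.Icc 1 N, wB N K n ≤ N * Real.log 4 *
      ∑ m ∈ Finset.Icc 1 N with m ∈ Nat.smoothNumbers (K + 1), (1 : ℝ) / m := by
  unfold wB
  rw [Finset.sum_comm, Finset.mul_sum]
  refine Finset.sum_le_sum fun m hm => ?_
  have hm1 : 1 ≤ m := (Finset.mem_Icc.1 (Finset.mem_filter.1 hm).1).1
  rw [Finset.sum_comm]
  simp only [Finset.sum_ite_eq']
  rw [← Finset.sum_filter]
  calc _ ≤ ∑ p ∈ Nat.primesLE (N / m), Real.log p := by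
        apply Finset.sum_le_sum_of_subset_of_nonneg
        · intro p hp
          rw [Finset.mem_filter, Nat.mem_primesLE, Finset.mem_Icc] at hp
          rw [Nat.mem_primesLE]
          refine ⟨?_, hp.1.2⟩
          rw [Nat.le_div_iff_mul_le (by omega), mul_comm]
          exact hp.2.2
        · intro p _ _; exact Real.log_natCast_nonneg p
    _ ≤ Real.log 4 * ((N / m : ℕ) : ℝ) := by
        rw [← Chebyshev.theta_eq_sum_primesLE_log]
        exact Chebyshev.theta_le_log4_mul_x (Nat.cast_nonneg _)
    _ ≤ Real.log 4 * ((N : ℝ) / m) := by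
        exact mul_le_mul_of_nonneg_left Nat.cast_div_le (Real.log_nonneg (by norm_num))
    _ = _ := by ring

lemma sumD (N : ℕ) : ∑ n ∈ Finset.Icc 1 N, wD N n ≤ N * 6 := by
  unfold wD
  rw [Finset.sum_comm]
  have h1 : ∀ b ∈ Finset.Icc 1 N,
      ∑ n ∈ Finset.Icc 1 N, (if b ^ 2 ∣ n then Real.log b else 0) ≤
        2 * N * (b : ℝ) ^ (-(1 + (1 / 2 : ℝ))) := by
    intro b hb
    have hb1 : 1 ≤ b := (Finset.mem_Icc.1 hb).1
    have hb0 : (0 : ℝ) < b := by exact_mod_cast hb1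
    rw [← Finset.sum_filter, Finset.sum_const, nsmul_eq_mul]
    have e : ((Finset.Icc 1 N).filter (fun n => b ^ 2 ∣ n)).card = N / b ^ 2 :=
      Nat.Ioc_filter_dvd_card_eq_div N (b ^ 2)
    rw [e]
    have h2 : ((N / b ^ 2 : ℕ) : ℝ) ≤ N * (b : ℝ) ^ (-2 : ℝ) := by
      refine Nat.cast_div_le.trans (le_of_eq ?_)
      rw [Real.rpow_neg hb0.le, div_eq_mul_inv]
      norm_num
    have h3 : Real.log b ≤ 2 * (b : ℝ) ^ (1 / 2 : ℝ) := by
      have := Real.log_le_rpow_div hb0.le (show (0 : ℝ) < 1 / 2 by norm_num)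
      linarith
    calc _ ≤ (N * (b : ℝ) ^ (-2 : ℝ)) * (2 * (b : ℝ) ^ (1 / 2 : ℝ)) :=
          mul_le_mul h2 h3 (Real.log_natCast_nonneg b) (by positivity)
      _ = 2 * N * ((b : ℝ) ^ (-2 : ℝ) * (b : ℝ) ^ (1 / 2 : ℝ)) := by ring
      _ = _ := by rw [← Real.rpow_add hb0]; norm_num
  refine (Finset.sum_le_sum h1).trans ?_
  rw [← Finset.mul_sum]
  have hs : Summable (fun n : ℕ => (n : ℝ) ^ (-(1 + (1 / 2 : ℝ)))) :=
    Real.summable_nat_rpow.2 (by norm_num)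
  have h2 := hs.sum_le_tsum (Finset.Icc 1 N) (fun i _ => by positivity)
  have h3 := zeta_le (1 / 2) (by norm_num)
  calc _ ≤ 2 * (N : ℝ) * 3 := by
        gcongr
        refine h2.trans (h3.trans ?_)
        norm_num
    _ = _ := by ring

lemma sum_log_compl (x : ℝ) (hx : 2 ≤ x) :
    ∑ n ∈ Finset.Icc 1 ⌊x⌋₊, (Real.log x - Real.log n) ≤ 2 * ⌊x⌋₊ := by
  set N := ⌊x⌋₊ with hN
  have hN1 : 1 ≤ N := Nat.le_floor (by push_cast; linarith)
  have hN0 : (1 : ℝ) ≤ N := by exact_mod_cast hN1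
  have hlt := Nat.lt_floor_add_one x
  rw [← hN] at hlt
  have h1 : Real.log x ≤ Real.log 2 + Real.log N := by
    rw [← Real.log_mul (by norm_num) (by linarith)]
    exact Real.log_le_log (by linarith) (by linarith)
  have h2 : ∑ n ∈ Finset.Icc 1 N, Real.log (n : ℝ) = Real.log N.factorial := by
    rw [← prod_Icc_fact]
    push_cast
    rw [Real.log_prod]
    intro i hi
    have := (Finset.mem_Icc.1 hi).1
    exact_mod_cast (by omega : i ≠ 0)
  have h3 : N * Real.log N - N ≤ Real.log N.factorial := by
    have := Real.pow_div_factorial_le_exp (x := (N : ℝ)) (by linarith) N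
    have hf : (0 : ℝ) < N.factorial := by exact_mod_cast Nat.factorial_pos N
    have := Real.log_le_log (by positivity) this
    rw [Real.log_exp, Real.log_div (by positivity) hf.ne', Real.log_pow] at this
    linarith
  rw [Finset.sum_sub_distrib, h2, Finset.sum_const, nsmul_eq_mul, Nat.card_Icc,
    Nat.add_sub_cancel]
  have h4 : Real.log 2 ≤ 1 := by linarith [Real.log_two_lt_d9]
  nlinarith

theorem tenenbaum_second_largest_small :
    ∃ c : ℝ, 0 < c ∧ ∀ x y : ℝ, 2 ≤ y → y ≤ x →
      ((((Finset.Icc 1 ⌊x⌋₊).filter fun n => (Pk 2 n : ℝ) ≤ y).card : ℝ))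
        ≤ c * (x * Real.log y / Real.log x) := by
  obtain ⟨C, hC, hsm⟩ := smooth_sum
  have hl2 : 0 < Real.log 2 := Real.log_pos (by norm_num)
  have hl4 : 0 < Real.log 4 := Real.log_pos (by norm_num)
  refine ⟨6 + Real.log 4 * C + 20 / Real.log 2, by positivity, ?_⟩
  intro x y hy hyx
  have hx : 2 ≤ x := hy.trans hyx
  have hlx : 0 < Real.log x := Real.log_pos (by linarith)
  have hly : Real.log 2 ≤ Real.log y := Real.log_le_log two_pos hy
  set N := ⌊x⌋₊ with hN
  set K := ⌊y⌋₊ with hK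
  have hNx : (N : ℝ) ≤ x := Nat.floor_le (by linarith)
  have hKy : (K : ℝ) ≤ y := Nat.floor_le (by linarith)
  have hK2 : 2 ≤ K := Nat.le_floor (by exact_mod_cast hy)
  have hlK : Real.log K ≤ Real.log y :=
    Real.log_le_log (by exact_mod_cast (by omega : 0 < K)) hKy
  set S := (Finset.Icc 1 N).filter fun n => (Pk 2 n : ℝ) ≤ y with hS
  have hSs : S ⊆ Finset.Icc 1 N := Finset.filter_subset _ _
  have h1 : ∑ n ∈ S, Real.log (n : ℝ) ≤
      ∑ n ∈ Finset.Icc 1 N, (wA K n + wB N K n + 3 * wD N n) := by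
    calc _ ≤ ∑ n ∈ S, (wA K n + wB N K n + 3 * wD N n) := by
          refine Finset.sum_le_sum fun n hn => ?_
          rw [hS, Finset.mem_filter, Finset.mem_Icc] at hn
          exact pointwise N K n hn.1.1 hn.1.2 (Pk_char n y hn.2)
      _ ≤ _ := by
          apply Finset.sum_le_sum_of_subset_of_nonneg hSs
          intro n _ _
          have := wA_nonneg K n
          have := wB_nonneg N K n
          have := wD_nonneg N n
          positivity
  rw [Finset.sum_add_distrib, Finset.sum_add_distrib, ← Finset.mul_sum] at h1
  have hA := sumA N K hK2
  have hB := sumB N K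
  have hD := sumD N
  have hB' : ∑ n ∈ Finset.Icc 1 N, wB N K n ≤ N * Real.log 4 * (C * Real.log K) :=
    hB.trans (mul_le_mul_of_nonneg_left (hsm N K hK2) (by positivity))
  have h2 : ∑ n ∈ S, (Real.log x - Real.log n) ≤ 2 * N := by
    refine le_trans ?_ (sum_log_compl x hx)
    apply Finset.sum_le_sum_of_subset_of_nonneg hSs
    intro n hn _
    have hn' := Finset.mem_Icc.1 hn
    have : Real.log n ≤ Real.log x := by
      apply Real.log_le_log (by exact_mod_cast hn'.1)
      exact le_trans (by exact_mod_cast hn'.2) hNx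
    linarith
  rw [Finset.sum_sub_distrib, Finset.sum_const, nsmul_eq_mul] at h2
  have h20 : 20 ≤ 20 / Real.log 2 * Real.log y := by
    rw [div_mul_eq_mul_div, le_div_iff₀ hl2]; linarith
  rw [← mul_div_assoc, le_div_iff₀ hlx]
  calc (S.card : ℝ) * Real.log x
      ≤ N * ((6 + Real.log 4 * C) * Real.log K + 20) := by linarith
    _ ≤ x * ((6 + Real.log 4 * C) * Real.log y + 20 / Real.log 2 * Real.log y) := by
        gcongr
    _ = _ := by ring
end
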